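/- Let E be a field, 𝒜 an E-linear abelian category, and K an object of the derived category D(𝒜) whose cohomology objects H^n(K) vanish for all n outside a bounded interval. Let Γ be an abelian group acting on K through a group homomorphism ρ from Γ to the automorphism group of K. Suppose given a finite set S of group homomorphisms (characters) χ : Γ → Eˣ and, for each integer n, a Γ-equivariant direct sum decomposition H^n(K) = ⊕_{χ∈S} H^n(K)_χ in 𝒜 such that for every χ ∈ S and every γ ∈ Γ the endomorphism H^n(ρ(γ)) − χ(γ)·id of H^n(K)_χ is nilpotent. Then there exists a decomposition K ≅ ⊕_{χ∈S} K_χ in D(𝒜), equivariant for the Γ-actions, such that for each χ ∈ S and γ ∈ Γ the endomorphism ρ_χ(γ) − χ(γ)·𝟙 of K_χ is nilpotent; such a decomposition is unique up to Γ-equivariant isomorphism, and it satisfies H^n(K_χ) ≅ H^n(K)_χ for all n and all χ ∈ S. -/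

import Mathlib

open CategoryTheory CategoryTheory.Limits
open CategoryTheory.Preadditive

section Algebra

variable {E A R J S : Type*} {B : J → Type*} [Field E] [CommRing A] [Algebra E A] [Ring R]
  [∀ j, Ring (B j)] [∀ j, Algebra E (B j)]

lemma CompleteOrthogonalIdempotents.exists_lift_of_ker_le [Fintype S] {T : Type*} [Ring T]
    (φ : A →+* R) (ψ : A →+* T) (h₀ : ∀ x, φ x = 0 → ψ x = 0)
    (h : ∀ x, ψ x = 0 → IsNilpotent (φ x)) {e : S → T} (he : CompleteOrthogonalIdempotents e)
    (he' : ∀ s, e s ∈ ψ.range) :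
    ∃ e' : S → A, CompleteOrthogonalIdempotents (φ ∘ e') ∧ ψ ∘ e' = e := by
  have hker : ∀ x ∈ RingHom.ker (Ideal.Quotient.lift (RingHom.ker φ) ψ h₀), IsNilpotent x := by
    intro x hx
    obtain ⟨x, rfl⟩ := Ideal.Quotient.mk_surjective x
    obtain ⟨n, hn⟩ := h x hx
    refine ⟨n, ?_⟩
    rw [← map_pow, Ideal.Quotient.eq_zero_iff_mem, RingHom.mem_ker, map_pow, hn]
  obtain ⟨f, hf, hfe⟩ := CompleteOrthogonalIdempotents.lift_of_isNilpotent_ker _ hker he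
    (fun s ↦ by
      obtain ⟨x, hx⟩ := he' s
      exact ⟨Ideal.Quotient.mk _ x, hx⟩)
  choose e' he' using fun s ↦ Ideal.Quotient.mk_surjective (f s)
  obtain rfl : (fun s ↦ Ideal.Quotient.mk _ (e' s)) = f := funext he'
  refine ⟨e', ?_, hfe⟩
  exact hf.map (RingHom.kerLift φ)

/-- If `t` acts with generalized eigenvalue `c` on some factors and `c' ≠ c` on others, some
polynomial in `t` acts as `1` on the former and as `0` on the latter. -/
lemma exists_eq_one_and_eq_zero_of_generalized_eigenvalues (Ψ : ∀ j, A →ₐ[E] B j)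
    (t : A) {c c' : E} (hc : c ≠ c') (N : ℕ) :
    ∃ u : A, (∀ j, (Ψ j t - c • 1) ^ N = 0 → Ψ j u = 1) ∧
      (∀ j, (Ψ j t - c' • 1) ^ N = 0 → Ψ j u = 0) := by
  let z : A := (c - c')⁻¹ • (t - c' • 1)
  have hz : z - 1 = (c - c')⁻¹ • (t - c • 1) := by
    have : (1 : A) = (c - c')⁻¹ • ((c - c') • 1) := by
      rw [smul_smul, inv_mul_cancel₀ (sub_ne_zero.2 hc), one_smul]
    simp only [z]
    nth_rewrite 2 [this]
    rw [← smul_sub, sub_smul]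
    congr 1
    abel
  obtain ⟨y, hy⟩ : z - 1 ∣ z ^ N - 1 := by simpa using sub_dvd_pow_sub_pow z 1 N
  refine ⟨1 - (1 - z ^ N) ^ N, fun j hj ↦ ?_, fun j hj ↦ ?_⟩
  · have : (1 - z ^ N) ^ N = (t - c • 1) ^ N * ((c - c')⁻¹ • (-y)) ^ N := by
      rw [← mul_pow, ← neg_sub (z ^ N), hy, hz]
      simp
    rw [map_sub, map_one, this, map_mul, map_pow, map_sub, map_smul, map_one, hj, zero_mul,
      sub_zero]
  · have : Ψ j (z ^ N) = 0 := by
      simp [z, smul_pow, hj]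
    simp [this]

lemma exists_completeOrthogonalIdempotents_of_generalized_eigenvalues
    [Fintype S] [DecidableEq S] (l : J → S)
    (φ : A →+* R) (Ψ : ∀ j, A →ₐ[E] B j) (h₀ : ∀ x, φ x = 0 → ∀ j, Ψ j x = 0)
    (h : ∀ x, (∀ j, Ψ j x = 0) → IsNilpotent (φ x))
    (hsep : ∀ s s', s ≠ s' → ∃ (t : A) (c c' : E) (N : ℕ), c ≠ c' ∧
      (∀ j, l j = s → (Ψ j t - c • 1) ^ N = 0) ∧
      (∀ j, l j = s' → (Ψ j t - c' • 1) ^ N = 0)) :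
    ∃ e : S → A, CompleteOrthogonalIdempotents (φ ∘ e) ∧
      ∀ s j, Ψ j (e s) = if l j = s then 1 else 0 := by
  have hu : ∀ s s', ∃ u : A, s ≠ s' →
      (∀ j, l j = s → Ψ j u = 1) ∧ (∀ j, l j = s' → Ψ j u = 0) := by
    intro s s'
    by_cases hs : s = s'
    · exact ⟨0, fun h ↦ (h hs).elim⟩
    · obtain ⟨t, c, c', N, hc, h₁, h₂⟩ := hsep s s' hs
      obtain ⟨u, hu₁, hu₂⟩ := exists_eq_one_and_eq_zero_of_generalized_eigenvalues Ψ t hc N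
      exact ⟨u, fun _ ↦ ⟨fun j hj ↦ hu₁ j (h₁ j hj), fun j hj ↦ hu₂ j (h₂ j hj)⟩⟩
  choose u hu using hu
  have hp : ∀ s j, Ψ j (∏ s' ∈ Finset.univ.erase s, u s s') = if l j = s then 1 else 0 := by
    intro s j
    split_ifs with hj
    · refine Finset.prod_induction (u s) (fun x ↦ Ψ j x = 1) ?_ (map_one _) ?_
      · intro x y hx hy
        rw [map_mul, hx, hy, one_mul]
      · exact fun s' hs' ↦ (hu s s' (Finset.ne_of_mem_erase hs').symm).1 j hj
    · rw [← Finset.mul_prod_erase _ _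
        (Finset.mem_erase.2 ⟨hj, Finset.mem_univ (l j)⟩), map_mul,
        (hu s (l j) (Ne.symm hj)).2 j rfl, zero_mul]
  have he : CompleteOrthogonalIdempotents
      (fun s j ↦ (if l j = s then 1 else 0 : B j)) := by
    refine ⟨⟨fun s ↦ ?_, fun s s' hs ↦ ?_⟩, ?_⟩
    · ext j
      by_cases hj : l j = s <;> simp [hj]
    · ext j
      by_cases hj : l j = s
      · simp [hj, hs]
      · simp [hj]
    · ext j
      simp
  obtain ⟨e, he₁, he₂⟩ := CompleteOrthogonalIdempotents.exists_lift_of_ker_le φ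
    (RingHom.pi fun j ↦ (Ψ j : A →+* B j)) (fun x hx ↦ funext (h₀ x hx))
    (fun x hx ↦ h x (congr_fun hx)) he (fun s ↦ ⟨_, funext (hp s)⟩)
  exact ⟨e, he₁, fun s j ↦ congr_fun (congr_fun he₂ s) j⟩

end Algebra

namespace CategoryTheory

/-- An endomorphism splits if it factors as a retraction followed by its section. -/
def SplitsEnd {D : Type*} [Category D] {X : D} (p : X ⟶ X) : Prop :=
  ∃ (Y : D) (i : Y ⟶ X) (r : X ⟶ Y), i ≫ r = 𝟙 Y ∧ r ≫ i = p

namespace Pretriangulated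

variable {D : Type*} [Category D] [Preadditive D] [HasZeroObject D] [HasShift D ℤ]
  [∀ n : ℤ, (shiftFunctor D n).Additive] [Pretriangulated D]

lemma comp_self_eq_zero_of_distTriang {T : Triangle D} (hT : T ∈ distTriang D)
    (d : T.obj₂ ⟶ T.obj₂) (h₁ : T.mor₁ ≫ d = 0) (h₃ : d ≫ T.mor₂ = 0) : d ≫ d = 0 := by
  obtain ⟨f, hf⟩ := Triangle.yoneda_exact₂ T hT d h₁
  nth_rewrite 2 [hf]
  rw [reassoc_of% h₃, zero_comp]

lemma splitsEnd_hom₂_of_distTriang {T : Triangle D} (hT : T ∈ distTriang D) (φ : T ⟶ T)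
    (hφ : φ.hom₂ ≫ φ.hom₂ = φ.hom₂) (h₁ : SplitsEnd φ.hom₁) (h₃ : SplitsEnd φ.hom₃) :
    SplitsEnd φ.hom₂ := by
  obtain ⟨X, i₁, r₁, hir₁, hri₁⟩ := h₁
  obtain ⟨Z, i₃, r₃, hir₃, hri₃⟩ := h₃
  obtain ⟨Y, f, g, hT'⟩ := distinguished_cocone_triangle₂ (i₃ ≫ T.mor₃ ≫ r₁⟦(1 : ℤ)⟧')
  have hri₁' : r₁⟦(1 : ℤ)⟧' ≫ i₁⟦(1 : ℤ)⟧' = φ.hom₁⟦(1 : ℤ)⟧' := by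
    rw [← Functor.map_comp, hri₁]
  have h₃φ : i₃ ≫ φ.hom₃ = i₃ := by rw [← hri₃, reassoc_of% hir₃]
  have hφr₁ : φ.hom₁ ≫ r₁ = r₁ := by rw [← hri₁, Category.assoc, hir₁, Category.comp_id]
  have hs : (i₃ ≫ T.mor₃ ≫ r₁⟦(1 : ℤ)⟧') ≫ i₁⟦(1 : ℤ)⟧' = i₃ ≫ T.mor₃ := by
    rw [Category.assoc, Category.assoc, hri₁', φ.comm₃, reassoc_of% h₃φ]
  have hr : T.mor₃ ≫ r₁⟦(1 : ℤ)⟧' = r₃ ≫ i₃ ≫ T.mor₃ ≫ r₁⟦(1 : ℤ)⟧' := by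
    rw [reassoc_of% hri₃, ← φ.comm₃_assoc, ← Functor.map_comp, hφr₁]
  obtain ⟨s, hs₁, hs₂⟩ : ∃ s : Y ⟶ T.obj₂, f ≫ s = i₁ ≫ T.mor₁ ∧ g ≫ i₃ = s ≫ T.mor₂ :=
    complete_distinguished_triangle_morphism₂ _ _ hT' hT i₁ i₃ hs
  obtain ⟨r, hr₁, hr₂⟩ : ∃ r : T.obj₂ ⟶ Y, T.mor₁ ≫ r = r₁ ≫ f ∧ T.mor₂ ≫ r₃ = r ≫ g :=
    complete_distinguished_triangle_morphism₂ _ _ hT hT' r₁ r₃ hr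
  have hv₁ : f ≫ s ≫ φ.hom₂ ≫ r = f := by
    rw [reassoc_of% hs₁, φ.comm₁_assoc, hr₁, reassoc_of% hφr₁, reassoc_of% hir₁]
  have hv₂ : (s ≫ φ.hom₂ ≫ r) ≫ g = g := by
    rw [Category.assoc, Category.assoc, ← hr₂, ← φ.comm₂_assoc, ← reassoc_of% hs₂,
      reassoc_of% h₃φ, hir₃, Category.comp_id]
  have hv₃ : (i₃ ≫ T.mor₃ ≫ r₁⟦(1 : ℤ)⟧') ≫ (𝟙 X)⟦(1 : ℤ)⟧' =
      𝟙 Z ≫ i₃ ≫ T.mor₃ ≫ r₁⟦(1 : ℤ)⟧' := by simp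
  have hv : IsIso (s ≫ φ.hom₂ ≫ r) :=
    isIso₂_of_isIso₁₃ (T := Triangle.mk f g _) (T' := Triangle.mk f g _)
      { hom₁ := 𝟙 X, hom₂ := s ≫ φ.hom₂ ≫ r, hom₃ := 𝟙 Z
        comm₁ := hv₁.trans (Category.id_comp f).symm
        comm₂ := (Category.comp_id g).trans hv₂.symm
        comm₃ := hv₃ } hT' hT' (inferInstance : IsIso (𝟙 X)) (inferInstance : IsIso (𝟙 Z))
  obtain ⟨w, hw, hw'⟩ := hv
  have hwf : f ≫ w = f := by
    nth_rewrite 1 [← hv₁]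
    rw [Category.assoc, hw, Category.comp_id]
  have hwg : w ≫ g = g := by
    nth_rewrite 1 [← hv₂]
    rw [← Category.assoc, hw', Category.id_comp]
  simp only [Category.assoc] at hw
  refine ⟨Y, s ≫ φ.hom₂, φ.hom₂ ≫ r ≫ w, by
    rw [Category.assoc, reassoc_of% hφ, hw], ?_⟩
  have key := comp_self_eq_zero_of_distTriang hT (φ.hom₂ - φ.hom₂ ≫ r ≫ w ≫ s ≫ φ.hom₂)
    (by
      rw [comp_sub, sub_eq_zero, φ.comm₁_assoc, reassoc_of% hr₁, reassoc_of% hwf,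
        reassoc_of% hs₁, reassoc_of% hφr₁, φ.comm₁, reassoc_of% hri₁, ← hri₁]
      simp only [Category.assoc, reassoc_of% hir₁])
    (by
      rw [sub_comp, sub_eq_zero]
      simp only [Category.assoc, ← φ.comm₂]
      rw [← reassoc_of% hs₂, reassoc_of% hwg, ← reassoc_of% hr₂, ← φ.comm₂_assoc, ← hri₃]
      simp only [Category.assoc, reassoc_of% hir₃])
  simp only [comp_sub, sub_comp, Category.assoc, reassoc_of% hφ, hφ, reassoc_of% hw,
    sub_self, sub_zero] at key
  simpa using (sub_eq_zero.1 key).symm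

end Pretriangulated
end CategoryTheory

namespace DerivedCategory

variable {C : Type*} [Category C] [Abelian C] [HasDerivedCategory C]
open TStructure Pretriangulated

lemma homologyFunctor_map_truncLE_map_eq_zero {K L : DerivedCategory C} (g : K ⟶ L) (k : ℤ)
    (hg : ∀ n, (homologyFunctor C n).map g = 0) (n : ℤ) :
    (homologyFunctor C n).map ((t.truncLE k).map g) = 0 := by
  by_cases hn : k < n
  · exact (isZero_of_isLE _ k n hn).eq_of_src _ _
  · have : Mono ((homologyFunctor C n).map ((t.truncLEι k).app L)) :=
      (HomologySequence.mono_homologyMap_mor₁_iff _ (t.triangleLEGT_distinguished k L)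
        (n - 1) n).2 ((isZero_of_isGE ((t.truncGT k).obj L) (k + 1) (n - 1) (by lia)).eq_of_src _ _)
    rw [← cancel_mono ((homologyFunctor C n).map ((t.truncLEι k).app L)), ← Functor.map_comp,
      (t.truncLEι k).naturality]
    simp [hg]

lemma homologyFunctor_map_truncGT_map_eq_zero {K L : DerivedCategory C} (g : K ⟶ L) (k : ℤ)
    (hg : ∀ n, (homologyFunctor C n).map g = 0) (n : ℤ) :
    (homologyFunctor C n).map ((t.truncGT k).map g) = 0 := by
  by_cases hn : n ≤ k
  · exact (isZero_of_isGE ((t.truncGT k).obj K) (k + 1) n (by lia)).eq_of_src _ _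
  · have : Epi ((homologyFunctor C n).map ((t.truncGTπ k).app K)) :=
      (HomologySequence.epi_homologyMap_mor₂_iff _ (t.triangleLEGT_distinguished k K)
        n (n + 1)).2 ((isZero_of_isLE ((t.truncLE k).obj K) k (n + 1) (by lia)).eq_of_tgt _ _)
    rw [← cancel_epi ((homologyFunctor C n).map ((t.truncGTπ k).app K)), ← Functor.map_comp,
      ← (t.truncGTπ k).naturality]
    simp [hg]

/-- The induction principle for bounded objects which reduces to objects concentrated in a
single degree by means of the truncation triangles. -/
lemma bounded_induction {P : DerivedCategory C → Prop}
    (single : ∀ (K : DerivedCategory C) (n : ℤ) [K.IsGE n] [K.IsLE n], P K)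
    (trunc : ∀ (K : DerivedCategory C) (n : ℤ),
      P ((t.truncLE n).obj K) → P ((t.truncGT n).obj K) → P K)
    (K : DerivedCategory C) (a b : ℤ) [K.IsGE a] [K.IsLE b] : P K := by
  obtain ⟨m, hm⟩ : ∃ m : ℕ, b ≤ a + m := ⟨(b - a).toNat, by lia⟩
  have : K.IsLE (a + m) := t.isLE_of_le K b _ hm
  clear hm
  induction m generalizing K with
  | zero =>
    have : K.IsLE a := by simpa using this
    exact single K a
  | succ m ih =>
    refine trunc K (a + m) (ih _ inferInstance) ?_
    have : K.IsLE (a + m + 1) := by simpa [add_assoc] using this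
    exact single _ (a + m + 1)

lemma splitsEnd_of_isGE_of_isLE (K : DerivedCategory C) (a b : ℤ) [K.IsGE a] [K.IsLE b]
    (p : K ⟶ K) (hp : p ≫ p = p) : SplitsEnd p := by
  revert p
  refine bounded_induction (P := fun K ↦ ∀ p : K ⟶ K, p ≫ p = p → SplitsEnd p)
    (fun K n _ _ p hp ↦ ?_) (fun K n h₁ h₃ p hp ↦ ?_) K a b
  · obtain ⟨Y, ⟨e⟩⟩ := exists_iso_singleFunctor_obj_of_isGE_of_isLE K n
    obtain ⟨q, hq⟩ := (singleFunctor C n).map_surjective (e.inv ≫ p ≫ e.hom)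
    have hqq : q ≫ q = q := (singleFunctor C n).map_injective (by
      simp [hq, reassoc_of% hp])
    obtain ⟨Z, i, r, hir, hri⟩ := IsIdempotentComplete.idempotents_split Y q hqq
    refine ⟨(singleFunctor C n).obj Z, (singleFunctor C n).map i ≫ e.inv,
      e.hom ≫ (singleFunctor C n).map r, ?_, ?_⟩
    · simp [← Functor.map_comp, hir]
    · rw [Category.assoc, ← Functor.map_comp_assoc, hri, hq]
      simp
  · refine splitsEnd_hom₂_of_distTriang (t.triangleLEGT_distinguished n K)
      ((t.triangleLEGT n).map p) hp (h₁ _ ?_) (h₃ _ ?_)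
    · exact ((t.truncLE n).map_comp p p).symm.trans (by rw [hp]; rfl)
    · exact ((t.truncGT n).map_comp p p).symm.trans (by rw [hp]; rfl)

lemma isNilpotent_of_homologyFunctor_map_eq_zero (K : DerivedCategory C) (a b : ℤ)
    [K.IsGE a] [K.IsLE b] (g : End K) (hg : ∀ n, (homologyFunctor C n).map g = 0) :
    IsNilpotent g := by
  revert g
  refine bounded_induction
    (P := fun K ↦ ∀ g : End K, (∀ n, (homologyFunctor C n).map g = 0) → IsNilpotent g)
    (fun K n _ _ g hg ↦ ?_) (fun K n h₁ h₃ g hg ↦ ?_) K a b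
  · obtain ⟨Y, ⟨e⟩⟩ := exists_iso_singleFunctor_obj_of_isGE_of_isLE K n
    obtain ⟨q, hq⟩ := (singleFunctor C n).map_surjective (e.inv ≫ g ≫ e.hom)
    have hq₀ : q = 0 := by
      have := NatIso.naturality_1 (singleFunctorCompHomologyFunctorIso C n) q
      simpa [hq, hg] using this.symm
    have : g = e.hom ≫ (singleFunctor C n).map q ≫ e.inv := by simp [hq]
    rw [this, hq₀]
    simp
  · obtain ⟨m₁, hm₁⟩ := h₁ ((t.truncLE n).map g)
      (homologyFunctor_map_truncLE_map_eq_zero g n hg)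
    obtain ⟨m₃, hm₃⟩ := h₃ ((t.truncGT n).map g)
      (homologyFunctor_map_truncGT_map_eq_zero g n hg)
    have hm₁' : (t.truncLE n).map (g ^ (m₁ + m₃)) = 0 := by
      have := map_pow ((t.truncLE n).mapEnd K) g (m₁ + m₃)
      exact this.trans (pow_eq_zero_of_le (Nat.le_add_right _ _) hm₁)
    have hm₃' : (t.truncGT n).map (g ^ (m₁ + m₃)) = 0 := by
      have := map_pow ((t.truncGT n).mapEnd K) g (m₁ + m₃)
      exact this.trans (pow_eq_zero_of_le (Nat.le_add_left _ _) hm₃)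
    refine ⟨(m₁ + m₃) * 2, ?_⟩
    rw [pow_mul, pow_two]
    refine comp_self_eq_zero_of_distTriang (t.triangleLEGT_distinguished n K) _ ?_ ?_
    · refine ((t.truncLEι n).naturality (g ^ (m₁ + m₃))).symm.trans ?_
      rw [hm₁', zero_comp]
      rfl
    · refine ((t.truncGTπ n).naturality (g ^ (m₁ + m₃))).trans ?_
      rw [hm₃', comp_zero]
      rfl

end DerivedCategory

namespace CategoryTheory

section Intertwiners

variable {D : Type*} [Category D]

lemma pow_comp_eq_comp_pow {X Y : D} {f : End X} {g : End Y} {ψ : X ⟶ Y}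
    (h : f ≫ ψ = ψ ≫ g) (n : ℕ) :
    (f ^ n : End X) ≫ ψ = ψ ≫ (g ^ n : End Y) := by
  induction n with
  | zero => exact (Category.id_comp ψ).trans (Category.comp_id ψ).symm
  | succ n ih =>
    rw [pow_succ, pow_succ, End.mul_def, End.mul_def, Category.assoc, ih, reassoc_of% h]

variable [Preadditive D] {E : Type*} [Field E] [Linear E D]

lemma sub_smul_one_comp_eq {X Y : D} {f : End X} {g : End Y} {ψ : X ⟶ Y}
    (h : f ≫ ψ = ψ ≫ g) (c : E) :
    (f - c • (1 : End X) : End X) ≫ ψ = ψ ≫ (g - c • (1 : End Y) : End Y) := by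
  refine (sub_comp f (c • 𝟙 X) ψ).trans (Eq.trans ?_ (comp_sub ψ g (c • 𝟙 Y)).symm)
  rw [h]
  simp

lemma isNilpotent_of_comp_eq {X Y : D} {f : End X} {g : End Y} {ψ : X ⟶ Y} [Mono ψ]
    (h : f ≫ ψ = ψ ≫ g) (hg : IsNilpotent g) : IsNilpotent f := by
  obtain ⟨n, hn⟩ := hg
  refine ⟨n, ?_⟩
  have := pow_comp_eq_comp_pow h n
  rw [hn] at this
  exact (cancel_mono ψ).1 (this.trans (comp_zero.trans zero_comp.symm))

/-- An intertwiner between endomorphisms with distinct generalized eigenvalues vanishes. -/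
lemma eq_zero_of_comp_eq_of_isNilpotent {X Y : D} {f : End X} {g : End Y} {ψ : X ⟶ Y}
    (h : f ≫ ψ = ψ ≫ g) {c d : E} (hcd : c ≠ d) (hf : IsNilpotent (f - c • (1 : End X)))
    (hg : IsNilpotent (g - d • (1 : End Y))) : ψ = 0 := by
  have hu : IsUnit (f - d • (1 : End X)) := by
    have h₁ : IsUnit ((c - d) • (1 : End X)) := by
      rw [← Algebra.algebraMap_eq_smul_one]
      exact (IsUnit.mk0 _ (sub_ne_zero.2 hcd)).map _
    have h₂ : f - d • (1 : End X) = (f - c • (1 : End X)) + (c - d) • (1 : End X) := by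
      rw [sub_smul]
      abel
    rw [h₂]
    refine hf.isUnit_add_right_of_commute h₁ ?_
    exact (Commute.one_right _).smul_right _
  obtain ⟨n, hn⟩ := hg
  have h₁ := pow_comp_eq_comp_pow (sub_smul_one_comp_eq h d) n
  rw [hn] at h₁
  have : IsIso ((f - d • (1 : End X)) ^ n : End X) :=
    (isUnit_iff_isIso _).1 (hu.pow n)
  exact (cancel_epi ((f - d • (1 : End X)) ^ n : End X)).1
    (h₁.trans (comp_zero.trans comp_zero.symm))

variable {Γ : Type*} [CommMonoid Γ]

lemma comp_map_lift_eq {C : Type*} [Category C] [Preadditive C] [Linear E C] (F : D ⥤ C)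
    [F.Additive] [F.Linear E] {K : D} {X : C} (ρ : Γ →* End K) (σ : Γ →* End X)
    (i : X ⟶ F.obj K) (h : ∀ γ, i ≫ F.map (ρ γ) = σ γ ≫ i) (x : MonoidAlgebra E Γ) :
    i ≫ F.map (MonoidAlgebra.lift E (End K) Γ ρ x) =
      (MonoidAlgebra.lift E (End X) Γ σ x : End X) ≫ i := by
  induction x using MonoidAlgebra.induction_on with
  | of γ => simpa using h γ
  | add x y hx hy =>
    rw [map_add, map_add]
    refine (congrArg (i ≫ ·) (F.map_add (f := MonoidAlgebra.lift E (End K) Γ ρ x))).trans ?_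
    refine (comp_add ..).trans ?_
    rw [hx, hy]
    exact (add_comp ..).symm
  | smul c x hx =>
    rw [map_smul, map_smul]
    refine (congrArg (i ≫ ·) (F.map_smul c (MonoidAlgebra.lift E (End K) Γ ρ x))).trans ?_
    refine (Linear.comp_smul ..).trans ?_
    rw [hx]
    exact (Linear.smul_comp ..).symm

end Intertwiners

section Decomposition

variable {E : Type*} [Field E] {D : Type*} [Category D] [Preadditive D] [Linear E D]
  {Γ S : Type*} [Fintype S]

/-- A decomposition of `K` into generalized eigen-summands for the action `ρ` of `Γ` with
generalized eigenvalues `c s γ` is given by inclusions `i s`, projections `r s` and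
endomorphisms `σ s γ` of the summands. -/
structure IsEigenDecomposition {K : D} (ρ : Γ → End K) (c : S → Γ → E) {Y : S → D}
    (i : ∀ s, Y s ⟶ K) (r : ∀ s, K ⟶ Y s) (σ : ∀ s, Γ → End (Y s)) : Prop where
  i_r (s : S) : i s ≫ r s = 𝟙 (Y s)
  i_r_of_ne (s s' : S) : s ≠ s' → i s ≫ r s' = 0
  sum : ∑ s, r s ≫ i s = 𝟙 K
  comm (s : S) (γ : Γ) : i s ≫ ρ γ = σ s γ ≫ i s
  isNilpotent (s : S) (γ : Γ) : IsNilpotent (σ s γ - c s γ • (1 : End (Y s)))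

namespace IsEigenDecomposition

variable {K : D} {ρ : Γ → End K} {c : S → Γ → E} {Y : S → D} {i : ∀ s, Y s ⟶ K}
  {r : ∀ s, K ⟶ Y s} {σ : ∀ s, Γ → End (Y s)}

lemma comm_r (h : IsEigenDecomposition ρ c i r σ) (s : S) (γ : Γ) :
    ρ γ ≫ r s = r s ≫ σ s γ := by
  classical
  have key : ρ γ ≫ r s = ∑ s', r s' ≫ σ s' γ ≫ i s' ≫ r s := by
    conv_lhs => rw [← Category.id_comp (ρ γ), ← h.sum]
    simp only [sum_comp, Category.assoc]
    exact Finset.sum_congr rfl fun s' _ ↦ by rw [reassoc_of% (h.comm s' γ)]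
  rw [key, Finset.sum_eq_single s, h.i_r]
  · exact congrArg (r s ≫ ·) (Category.comp_id (σ s γ))
  · intro s' _ hs
    rw [h.i_r_of_ne s' s hs, comp_zero, comp_zero]
  · simp

variable {Y' : S → D} {i' : ∀ s, Y' s ⟶ K} {r' : ∀ s, K ⟶ Y' s} {σ' : ∀ s, Γ → End (Y' s)}

lemma comm_i_r (h : IsEigenDecomposition ρ c i r σ) (h' : IsEigenDecomposition ρ c i' r' σ')
    (s s' : S) (γ : Γ) : σ s γ ≫ i s ≫ r' s' = (i s ≫ r' s') ≫ σ' s' γ := by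
  rw [← reassoc_of% h.comm s γ, h'.comm_r, Category.assoc]

lemma i_r_eq_zero (h : IsEigenDecomposition ρ c i r σ) (h' : IsEigenDecomposition ρ c i' r' σ')
    (hc : Function.Injective c) (s s' : S) (hs : s ≠ s') : i s ≫ r' s' = 0 := by
  obtain ⟨γ, hγ⟩ := Function.ne_iff.1 (hc.ne hs)
  exact eq_zero_of_comp_eq_of_isNilpotent (h.comm_i_r h' s s' γ) hγ
    (h.isNilpotent s γ) (h'.isNilpotent s' γ)

lemma i_r_i_r (h : IsEigenDecomposition ρ c i r σ) (h' : IsEigenDecomposition ρ c i' r' σ')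
    (hc : Function.Injective c) (s : S) : (i s ≫ r' s) ≫ i' s ≫ r s = 𝟙 (Y s) := by
  classical
  have key : i s ≫ (∑ s', r' s' ≫ i' s') ≫ r s = 𝟙 (Y s) := by
    rw [h'.sum, Category.id_comp, h.i_r]
  rw [← key, sum_comp, comp_sum, Finset.sum_eq_single s]
  · simp
  · intro s' _ hs
    rw [Category.assoc, reassoc_of% h.i_r_eq_zero h' hc s s' hs.symm, zero_comp]
  · simp

/-- The comparison isomorphism between the summands of two decompositions into generalized
eigen-summands. -/
def iso (h : IsEigenDecomposition ρ c i r σ) (h' : IsEigenDecomposition ρ c i' r' σ')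
    (hc : Function.Injective c) (s : S) : Y s ≅ Y' s where
  hom := i s ≫ r' s
  inv := i' s ≫ r s
  hom_inv_id := h.i_r_i_r h' hc s
  inv_hom_id := h'.i_r_i_r h hc s

end IsEigenDecomposition

/-- Let `H n` be functors which jointly detect nilpotency of endomorphisms of `K`, an object
whose idempotents split. A decomposition of the `(H n).obj K` into generalized eigen-summands
with uniformly bounded exponents lifts to `K`. -/
theorem exists_isEigenDecomposition [CommMonoid Γ] {C N : Type*} [Category C] [Preadditive C]
    [Linear E C]
    (H : N → D ⥤ C) [∀ n, (H n).Additive] [∀ n, (H n).Linear E] (K : D)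
    (hK : ∀ p : K ⟶ K, p ≫ p = p → SplitsEnd p)
    (hH : ∀ g : End K, (∀ n, (H n).map g = 0) → IsNilpotent g)
    (ρ : Γ →* End K) (c : S → Γ → E) (hc : Function.Injective c) (X : N → S → C)
    (i : ∀ n s, X n s ⟶ (H n).obj K) (r : ∀ n s, (H n).obj K ⟶ X n s)
    (σ : ∀ n s, Γ → End (X n s))
    (h : ∀ n, IsEigenDecomposition (fun γ ↦ ((H n).map (ρ γ) : End ((H n).obj K))) c
      (i n) (r n) (σ n))
    (hσ : ∀ γ, ∃ m : ℕ, ∀ n s, (σ n s γ - c s γ • (1 : End (X n s))) ^ m = 0) :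
    ∃ (Y : S → D) (iK : ∀ s, Y s ⟶ K) (rK : ∀ s, K ⟶ Y s) (σK : ∀ s, Γ → End (Y s)),
      IsEigenDecomposition ρ c iK rK σK ∧ ∀ n s, Nonempty ((H n).obj (Y s) ≅ X n s) := by
  classical
  have hmono (n : N) (s : S) : Mono (i n s) := ⟨fun f g hfg ↦ by
    simpa [(h n).i_r] using congrArg (· ≫ r n s) hfg⟩
  let τ (j : N × S) : Γ →* End (X j.1 j.2) :=
    { toFun := σ j.1 j.2
      map_one' := by
        rw [← cancel_mono (i j.1 j.2), ← (h j.1).comm]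
        simp [End.one_def]
      map_mul' := fun γ γ' ↦ by
        rw [← cancel_mono (i j.1 j.2), ← (h j.1).comm]
        simp only [map_mul, End.mul_def, Functor.map_comp, Category.assoc]
        rw [← (h j.1).comm, ← reassoc_of% (h j.1).comm] }
  let φ := MonoidAlgebra.lift E (End K) Γ ρ
  let Ψ (j : N × S) := MonoidAlgebra.lift E (End (X j.1 j.2)) Γ (τ j)
  have hφΨ (n : N) (s : S) (x : MonoidAlgebra E Γ) :
      i n s ≫ (H n).map (φ x) = (Ψ (n, s) x : End (X n s)) ≫ i n s :=
    comp_map_lift_eq (H n) ρ (τ (n, s)) (i n s) ((h n).comm s) x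
  have hzero (n : N) (g : End K) (hg : ∀ s, i n s ≫ (H n).map g = 0) : (H n).map g = 0 := by
    rw [← Category.id_comp ((H n).map g), ← (h n).sum, sum_comp]
    exact Finset.sum_eq_zero fun s _ ↦ by rw [Category.assoc, hg, comp_zero]
  have hφ (x : MonoidAlgebra E Γ) (hx : ∀ j, Ψ j x = 0) : IsNilpotent (φ x) :=
    hH _ fun n ↦ hzero n _ fun s ↦ by
      rw [hφΨ, hx]
      exact zero_comp
  have hΨ (x : MonoidAlgebra E Γ) (hx : φ x = 0) (j : N × S) : Ψ j x = 0 := by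
    refine (cancel_mono (i j.1 j.2)).1 ((hφΨ j.1 j.2 x).symm.trans ?_)
    rw [hx]
    refine (congrArg (i j.1 j.2 ≫ ·) ((H j.1).map_zero K K)).trans ?_
    exact comp_zero.trans zero_comp.symm
  have hΨσ (j : N × S) (γ : Γ) : Ψ j (MonoidAlgebra.of E Γ γ) = σ j.1 j.2 γ := by
    simp [Ψ, τ]
  obtain ⟨e, he, hΨe⟩ := exists_completeOrthogonalIdempotents_of_generalized_eigenvalues
    (fun j : N × S ↦ j.2) (φ : MonoidAlgebra E Γ →+* End K) Ψ hΨ hφ (fun s s' hs ↦ by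
      obtain ⟨γ, hγ⟩ := Function.ne_iff.1 (hc.ne hs)
      obtain ⟨m, hm⟩ := hσ γ
      refine ⟨MonoidAlgebra.of E Γ γ, c s γ, c s' γ, m, hγ, ?_, ?_⟩
      · rintro j rfl
        rw [hΨσ, hm]
      · rintro j rfl
        rw [hΨσ, hm])
  choose Y iK rK hir hri using fun s ↦ hK (φ (e s)) (he.idem s)
  have hi (s : S) : iK s ≫ φ (e s) = iK s := by
    rw [← hri, reassoc_of% hir]
  have hr (s : S) : φ (e s) ≫ rK s = rK s := by
    rw [← hri, Category.assoc, hir, Category.comp_id]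
  have hcomm (x y : MonoidAlgebra E Γ) : φ x ≫ φ y = φ y ≫ φ x := by
    rw [← End.mul_def, ← End.mul_def, ← map_mul, ← map_mul, mul_comm]
  have hmonoK (s : S) : Mono (iK s) := ⟨fun f g hfg ↦ by
    simpa [hir] using congrArg (· ≫ rK s) hfg⟩
  have hρ (γ : Γ) : φ (MonoidAlgebra.of E Γ γ) = ρ γ := by simp [φ]
  have hequiv (s : S) (γ : Γ) : iK s ≫ ρ γ = (iK s ≫ ρ γ ≫ rK s) ≫ iK s := by
    rw [Category.assoc, Category.assoc, hri, ← hρ, hcomm, reassoc_of% hi]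
  have hHe (n : N) (s : S) : r n s ≫ i n s = (H n).map (φ (e s)) := by
    rw [← Category.id_comp ((H n).map (φ (e s))), ← (h n).sum, sum_comp,
      Finset.sum_eq_single s]
    · rw [Category.assoc, hφΨ, hΨe, if_pos rfl, End.one_def, Category.id_comp]
    · intro s' _ hs
      rw [Category.assoc, hφΨ, hΨe, if_neg hs]
      exact (congrArg (r n s' ≫ ·) zero_comp).trans comp_zero
    · simp
  refine ⟨Y, iK, rK, fun s γ ↦ iK s ≫ ρ γ ≫ rK s, ⟨hir, fun s s' hs ↦ ?_, ?_, hequiv,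
    fun s γ ↦ ?_⟩, fun n s ↦ ?_⟩
  · rw [← hi, ← hr s', Category.assoc]
    have : φ (e s) ≫ φ (e s') = 0 := he.ortho hs.symm
    rw [reassoc_of% this, zero_comp, comp_zero]
  · simp only [hri]
    exact he.complete
  · let x := (MonoidAlgebra.of E Γ γ - c s γ • 1) * e s
    have hx : IsNilpotent (φ x) := by
      obtain ⟨m, hm⟩ := hσ γ
      have : IsNilpotent (φ x ^ (m + 1)) := by
        rw [← map_pow]
        refine hφ _ fun j ↦ ?_
        rw [map_pow, map_mul, map_sub, map_smul, map_one, hΨσ, hΨe]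
        split_ifs with hj
        · obtain rfl := hj
          rw [mul_one, pow_succ, hm, zero_mul]
        · simp
      exact this.of_pow
    refine isNilpotent_of_comp_eq (ψ := iK s) ?_ hx
    refine (sub_smul_one_comp_eq (hequiv s γ).symm (c s γ)).trans ?_
    simp only [x]
    rw [map_mul, map_sub, map_smul, map_one, hρ, End.mul_def, reassoc_of% hi]
  · refine ⟨(H n).map (iK s) ≫ r n s, i n s ≫ (H n).map (rK s), ?_, ?_⟩
    · rw [Category.assoc, reassoc_of% hHe n s, ← Functor.map_comp, ← hri, Category.assoc, hir,
        Category.comp_id, ← Functor.map_comp, hir, Functor.map_id]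
    · rw [Category.assoc, ← Functor.map_comp_assoc, hri, ← hHe, Category.assoc, (h n).i_r,
        Category.comp_id, (h n).i_r]

end Decomposition

end CategoryTheory

/-- Lemme 3.2.5: let `K` be a bounded object of the derived category of an `E`-linear
abelian category `C`, with an action `ρ` of an abelian group `Γ`.  Suppose given, for a
finite set `S` of characters `χ : Γ → Eˣ`, a `Γ`-equivariant direct sum decomposition
`H^n(K) = ⊕_{χ ∈ S} H^n(K)_χ` (expressed by inclusions `ι`, projections `π` and the
biproduct identities) on which `γ − χ(γ)` acts nilpotently.  Then `K` itself admits a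
`Γ`-equivariant decomposition `K ≅ ⊕_{χ ∈ S} K_χ` with `ρ_χ(γ) − χ(γ)·𝟙` nilpotent and
`H^n(K_χ) ≅ H^n(K)_χ`; it is unique up to `Γ`-equivariant isomorphism. -/
theorem stmt_8 (E : Type*) [Field E]
    (C : Type*) [Category C] [Abelian C] [CategoryTheory.Linear E C]
    [HasDerivedCategory C]
    [CategoryTheory.Linear E (DerivedCategory C)]
    [∀ n : ℤ, Functor.Linear E (DerivedCategory.homologyFunctor C n)]
    (K : DerivedCategory C) (a b : ℤ)
    (hbdd : ∀ n : ℤ, n < a ∨ b < n →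
      IsZero ((DerivedCategory.homologyFunctor C n).obj K))
    (Γ : Type*) [CommGroup Γ] (ρ : Γ →* Aut K)
    (S : Finset (Γ →* Eˣ))
    (Hobj : ℤ → S → C)
    (ι : ∀ (n : ℤ) (χ : S), Hobj n χ ⟶ (DerivedCategory.homologyFunctor C n).obj K)
    (π : ∀ (n : ℤ) (χ : S), (DerivedCategory.homologyFunctor C n).obj K ⟶ Hobj n χ)
    (hιπ : ∀ (n : ℤ) (χ : S), ι n χ ≫ π n χ = 𝟙 (Hobj n χ))
    (hιπ' : ∀ (n : ℤ) (χ χ' : S), χ ≠ χ' → ι n χ ≫ π n χ' = 0)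
    (hsum : ∀ n : ℤ, ∑ χ : S, π n χ ≫ ι n χ =
      𝟙 ((DerivedCategory.homologyFunctor C n).obj K))
    (act : ∀ (n : ℤ) (χ : S), Γ → End (Hobj n χ))
    (hequiv : ∀ (n : ℤ) (χ : S) (γ : Γ),
      ι n χ ≫ (DerivedCategory.homologyFunctor C n).map (ρ γ).hom =
        (act n χ γ : Hobj n χ ⟶ Hobj n χ) ≫ ι n χ)
    (hnilp : ∀ (n : ℤ) (χ : S) (γ : Γ),
      IsNilpotent (act n χ γ - ((χ : Γ →* Eˣ) γ : E) • (1 : End (Hobj n χ)))) :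
    ∃ (Kobj : S → DerivedCategory C)
      (ιK : ∀ χ : S, Kobj χ ⟶ K) (πK : ∀ χ : S, K ⟶ Kobj χ)
      (ρK : ∀ χ : S, Γ → End (Kobj χ)),
      (∀ χ : S, ιK χ ≫ πK χ = 𝟙 (Kobj χ)) ∧
      (∀ χ χ' : S, χ ≠ χ' → ιK χ ≫ πK χ' = 0) ∧
      (∑ χ : S, πK χ ≫ ιK χ = 𝟙 K) ∧
      (∀ (χ : S) (γ : Γ),
        ιK χ ≫ (ρ γ).hom = (ρK χ γ : Kobj χ ⟶ Kobj χ) ≫ ιK χ) ∧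
      (∀ (χ : S) (γ : Γ),
        IsNilpotent (ρK χ γ - ((χ : Γ →* Eˣ) γ : E) • (1 : End (Kobj χ)))) ∧
      (∀ (n : ℤ) (χ : S),
        Nonempty ((DerivedCategory.homologyFunctor C n).obj (Kobj χ) ≅ Hobj n χ)) ∧
      ∀ (Kobj' : S → DerivedCategory C)
        (ιK' : ∀ χ : S, Kobj' χ ⟶ K) (πK' : ∀ χ : S, K ⟶ Kobj' χ)
        (ρK' : ∀ χ : S, Γ → End (Kobj' χ)),
        (∀ χ : S, ιK' χ ≫ πK' χ = 𝟙 (Kobj' χ)) →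
        (∀ χ χ' : S, χ ≠ χ' → ιK' χ ≫ πK' χ' = 0) →
        (∑ χ : S, πK' χ ≫ ιK' χ = 𝟙 K) →
        (∀ (χ : S) (γ : Γ),
          ιK' χ ≫ (ρ γ).hom = (ρK' χ γ : Kobj' χ ⟶ Kobj' χ) ≫ ιK' χ) →
        (∀ (χ : S) (γ : Γ),
          IsNilpotent (ρK' χ γ - ((χ : Γ →* Eˣ) γ : E) • (1 : End (Kobj' χ)))) →
        ∀ χ : S, ∃ φ : Kobj χ ≅ Kobj' χ,
          ∀ γ : Γ, φ.hom ≫ (ρK' χ γ : Kobj' χ ⟶ Kobj' χ) =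
            (ρK χ γ : Kobj χ ⟶ Kobj χ) ≫ φ.hom := by
  have hGE : K.IsGE a := (DerivedCategory.isGE_iff K a).2 fun n hn ↦ hbdd n (Or.inl hn)
  have hLE : K.IsLE b := (DerivedCategory.isLE_iff K b).2 fun n hn ↦ hbdd n (Or.inr hn)
  let c (χ : S) (γ : Γ) : E := ((χ : Γ →* Eˣ) γ : E)
  have hc : Function.Injective c := fun χ χ' h ↦
    Subtype.ext (MonoidHom.ext fun γ ↦ Units.ext (congr_fun h γ))
  have hunif (γ : Γ) : ∃ m : ℕ, ∀ n χ, (act n χ γ - c χ γ • (1 : End (Hobj n χ))) ^ m = 0 := by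
    choose m hm using fun n χ ↦ hnilp n χ γ
    refine ⟨(Finset.Icc a b ×ˢ Finset.univ).sup fun j ↦ m j.1 j.2, fun n χ ↦ ?_⟩
    by_cases hn : n ∈ Finset.Icc a b
    · exact pow_eq_zero_of_le (Finset.le_sup (f := fun j : ℤ × S ↦ m j.1 j.2)
        (Finset.mk_mem_product hn (Finset.mem_univ χ))) (hm n χ)
    · have hz : IsZero (Hobj n χ) := by
        refine (IsZero.iff_id_eq_zero _).2 ?_
        rw [← hιπ, (hbdd n (by simp at hn; lia)).eq_of_tgt (ι n χ) 0, zero_comp]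
      exact hz.eq_of_src _ _
  obtain ⟨Kobj, ιK, πK, ρK, hdec, hiso⟩ := exists_isEigenDecomposition
    (fun n ↦ DerivedCategory.homologyFunctor C n) K
    (DerivedCategory.splitsEnd_of_isGE_of_isLE K a b)
    (DerivedCategory.isNilpotent_of_homologyFunctor_map_eq_zero K a b)
    ((Aut.toEnd K).comp ρ) c hc Hobj ι π act
    (fun n ↦ ⟨hιπ n, hιπ' n, hsum n, hequiv n, hnilp n⟩) hunif
  refine ⟨Kobj, ιK, πK, ρK, hdec.i_r, hdec.i_r_of_ne, hdec.sum, hdec.comm, hdec.isNilpotent,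
    hiso, fun Kobj' ιK' πK' ρK' h₁ h₂ h₃ h₄ h₅ χ ↦ ?_⟩
  have hdec' : IsEigenDecomposition ((Aut.toEnd K).comp ρ) c ιK' πK' ρK' := ⟨h₁, h₂, h₃, h₄, h₅⟩
  exact ⟨hdec.iso hdec' hc χ, fun γ ↦ (hdec.comm_i_r hdec' χ χ γ).symm⟩
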